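/- Let Ω ⊂ ℝ^N (N ≥ 2) be a smooth bounded domain, assume (S1), (P1), (μ1), let q ∈ C₊(ℝ^N×ℝ^N) satisfy 2/q(x,y) + μ(x,y)/N = 2, and let f satisfy (F1) with r ∈ C₊(ℝ^N)∩𝓜. Then there exists a constant c > 0, independent of u, such that for every u ∈ X₀, |∫_Ω∫_Ω F(x,u(x))F(y,u(y))/|x−y|^{μ(x,y)} dx dy| ≤ c·max{‖u‖_{X₀}^{2r⁺}, ‖u‖_{X₀}^{2r⁻}}. -/

import Mathlib

open MeasureTheory Set Filter ENNReal

noncomputable section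

namespace VarOrderChoquard

variable {N : ℕ}

/-- `ℝ^N` with the Euclidean structure. -/
abbrev RN (N : ℕ) := EuclideanSpace ℝ (Fin N)

/-- `Φ⁻` : infimum of a two-variable real function over `ℝ^N × ℝ^N`. -/
def inf2 (f : RN N → RN N → ℝ) : ℝ := sInf {t | ∃ x y, f x y = t}

/-- `Φ⁺` : supremum of a two-variable real function over `ℝ^N × ℝ^N`. -/
def sup2 (f : RN N → RN N → ℝ) : ℝ := sSup {t | ∃ x y, f x y = t}

/-- `Φ⁻` over a subset `D ⊆ ℝ^N`. -/
def infOn (D : Set (RN N)) (g : RN N → ℝ) : ℝ := sInf (g '' D)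

/-- `Φ⁺` over a subset `D ⊆ ℝ^N`. -/
def supOn (D : Set (RN N)) (g : RN N → ℝ) : ℝ := sSup (g '' D)

/-- `C₊(ℝ^N × ℝ^N)` : continuous with `1 < Φ⁻ ≤ Φ⁺ < ∞`. -/
def CPlus2 (f : RN N → RN N → ℝ) : Prop :=
  Continuous (fun z : RN N × RN N => f z.1 z.2) ∧ 1 < inf2 f ∧
    BddAbove {t | ∃ x y, f x y = t}

/-- `C₊(D)` for `D ⊆ ℝ^N`. -/
def CPlusOn (D : Set (RN N)) (g : RN N → ℝ) : Prop :=
  ContinuousOn g D ∧ 1 < infOn D g ∧ BddAbove (g '' D)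

/-- Condition (S1). -/
def S1 (s : RN N → RN N → ℝ) : Prop :=
  Continuous (fun z : RN N × RN N => s z.1 z.2) ∧ (∀ x y, s x y = s y x) ∧
    BddAbove {t | ∃ x y, s x y = t} ∧ 0 < inf2 s ∧ sup2 s < 1

/-- Condition (P1). -/
def P1 (s p : RN N → RN N → ℝ) : Prop :=
  CPlus2 p ∧ (∀ x y, p x y = p y x) ∧ sup2 s * sup2 p < N

/-- Condition (μ1). -/
def Mu1 (μ : RN N → RN N → ℝ) : Prop :=
  (∀ x y, μ x y = μ y x) ∧ BddAbove {t | ∃ x y, μ x y = t} ∧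
    0 < inf2 μ ∧ sup2 μ < N

/-- The critical exponent `p_s*(x) = N p(x,x) / (N - s(x,x) p(x,x))`. -/
def pstar (s p : RN N → RN N → ℝ) (x : RN N) : ℝ :=
  N * p x x / (N - s x x * p x x)

/-- The class `𝓜` : `p(x,x) ≤ r(x)q⁻ ≤ r(x)q⁺ < p_s*(x)` for all `x`. -/
def MemM (s p q : RN N → RN N → ℝ) (r : RN N → ℝ) : Prop :=
  ∀ x, p x x ≤ r x * inf2 q ∧ r x * inf2 q ≤ r x * sup2 q ∧
    r x * sup2 q < pstar s p x

/-- Variable-exponent modular `∫_U |u/l|^{γ(x)} dx`. -/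
def lmodular (U : Set (RN N)) (γ : RN N → ℝ) (u : RN N → ℝ) (l : ℝ) : ℝ≥0∞ :=
  ∫⁻ x in U, ENNReal.ofReal (|u x| / l) ^ γ x

/-- Membership in the variable-exponent Lebesgue space `L^{γ(x)}(U)`. -/
def MemVarLp (U : Set (RN N)) (γ : RN N → ℝ) (u : RN N → ℝ) : Prop :=
  Measurable u ∧ ∃ l, 0 < l ∧ lmodular U γ u l < ⊤

/-- Luxemburg norm on `L^{γ(x)}(U)`. -/
def luxNorm (U : Set (RN N)) (γ : RN N → ℝ) (u : RN N → ℝ) : ℝ :=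
  sInf {l | 0 < l ∧ lmodular U γ u l ≤ 1}

/-- Membership in the classical Lebesgue space `L^t(U)` (constant exponent `t`). -/
def MemCLp (U : Set (RN N)) (t : ℝ) (g : RN N → ℝ) : Prop :=
  Measurable g ∧ (∫⁻ x in U, ENNReal.ofReal |g x| ^ t) < ⊤

/-- The classical `L^t(U)`-norm. -/
def cLpNorm (U : Set (RN N)) (t : ℝ) (g : RN N → ℝ) : ℝ :=
  (∫⁻ x in U, ENNReal.ofReal |g x| ^ t).toReal ^ (1 / t)

/-- Gagliardo-type modular
`∫_A (|u(x)-u(y)|/l)^{p(x,y)} / |x-y|^{N+s(x,y)p(x,y)} dx dy`. -/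
def gmodular (A : Set (RN N × RN N)) (s p : RN N → RN N → ℝ) (u : RN N → ℝ)
    (l : ℝ) : ℝ≥0∞ :=
  ∫⁻ z in A, ENNReal.ofReal (|u z.1 - u z.2| / l) ^ p z.1 z.2 /
    ENNReal.ofReal (dist z.1 z.2) ^ ((N : ℝ) + s z.1 z.2 * p z.1 z.2)

/-- Membership in `W^{s(x,y),β(x),p(x,y)}(U)`. -/
def MemW (U : Set (RN N)) (s p : RN N → RN N → ℝ) (β : RN N → ℝ)
    (u : RN N → ℝ) : Prop :=
  MemVarLp U β u ∧ ∃ l, 0 < l ∧ gmodular (U ×ˢ U) s p u l < ⊤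

/-- The Gagliardo seminorm `[u]_U^{s,p}`. -/
def wSeminorm (U : Set (RN N)) (s p : RN N → RN N → ℝ) (u : RN N → ℝ) : ℝ :=
  sInf {l | 0 < l ∧ gmodular (U ×ˢ U) s p u l < 1}

/-- The norm on `W`. -/
def wNorm (U : Set (RN N)) (s p : RN N → RN N → ℝ) (β : RN N → ℝ)
    (u : RN N → ℝ) : ℝ :=
  luxNorm U β u + wSeminorm U s p u

/-- `Q = (ℝ^N × ℝ^N) \ (Ωᶜ × Ωᶜ)`. -/
def Qset (Ω : Set (RN N)) : Set (RN N × RN N) := univ \ (Ωᶜ ×ˢ Ωᶜ)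

/-- Membership in `X₀`. -/
def MemX0 (Ω : Set (RN N)) (s p : RN N → RN N → ℝ) (β : RN N → ℝ)
    (u : RN N → ℝ) : Prop :=
  Measurable u ∧ MemVarLp Ω β u ∧ (∃ l, 0 < l ∧ gmodular (Qset Ω) s p u l < ⊤) ∧
    (∀ᵐ x, x ∉ Ω → u x = 0)

/-- The `X₀`-norm. -/
def x0Norm (s p : RN N → RN N → ℝ) (u : RN N → ℝ) : ℝ :=
  sInf {l | 0 < l ∧ gmodular univ s p u l < 1}

/-- The modular `ρ_{X₀}`. -/
def rhoX0 (s p : RN N → RN N → ℝ) (u : RN N → ℝ) : ℝ≥0∞ :=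
  gmodular univ s p u 1

/-- Carathéodory function. -/
def Caratheodory (f : RN N → ℝ → ℝ) : Prop :=
  (∀ t, Measurable fun x => f x t) ∧ ∀ x, Continuous fun t => f x t

/-- `F(x,t) = ∫₀ᵗ f(x,τ) dτ`. -/
def Fant (f : RN N → ℝ → ℝ) (x : RN N) (t : ℝ) : ℝ := ∫ τ in (0:ℝ)..t, f x τ

/-- Growth condition (F1) (with data `M` and `r`). -/
def F1 (Ω : Set (RN N)) (f : RN N → ℝ → ℝ) (M : ℝ) (r : RN N → ℝ) : Prop :=
  0 < M ∧ ∀ x ∈ Ω, ∀ t : ℝ, |f x t| ≤ M * |t| ^ (r x - 1)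

/-- Ambrosetti–Rabinowitz type condition (F2) (with data `Θ`). -/
def F2 (Ω : Set (RN N)) (f : RN N → ℝ → ℝ) (Θ : ℝ) : Prop :=
  ∀ᵐ x, x ∈ Ω → ∀ t : ℝ, t ≠ 0 →
    0 < Θ * Fant f x t ∧ Θ * Fant f x t ≤ 2 * (t * f x t)

/-- The left-hand side pairing
`∫∫ |u(x)-u(y)|^{p-2}(u(x)-u(y))(w(x)-w(y)) / |x-y|^{N+sp} dx dy`. -/
def energyLHS (s p : RN N → RN N → ℝ) (u w : RN N → ℝ) : ℝ :=
  ∫ z : RN N × RN N,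
    |u z.1 - u z.2| ^ (p z.1 z.2 - 2) * (u z.1 - u z.2) * (w z.1 - w z.2) /
      dist z.1 z.2 ^ ((N : ℝ) + s z.1 z.2 * p z.1 z.2)

/-- The Choquard right-hand side `∫_Ω ∫_Ω F(x,u(x)) f(y,u(y)) w(y) / |x-y|^μ`. -/
def choquardRHS (Ω : Set (RN N)) (μ : RN N → RN N → ℝ) (f : RN N → ℝ → ℝ)
    (u w : RN N → ℝ) : ℝ :=
  ∫ x in Ω, ∫ y in Ω, Fant f x (u x) * f y (u y) * w y / dist x y ^ μ x y

/-- The energy functional `J`. -/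
def Jfun (Ω : Set (RN N)) (s p μ : RN N → RN N → ℝ) (f : RN N → ℝ → ℝ)
    (u : RN N → ℝ) : ℝ :=
  (∫ z : RN N × RN N,
    |u z.1 - u z.2| ^ p z.1 z.2 /
      (p z.1 z.2 * dist z.1 z.2 ^ ((N : ℝ) + s z.1 z.2 * p z.1 z.2)))
  - (1/2) * ∫ x in Ω, ∫ y in Ω,
      Fant f x (u x) * Fant f y (u y) / dist x y ^ μ x y

/-- `⟨J'(u), w⟩`. -/
def Jderiv (Ω : Set (RN N)) (s p μ : RN N → RN N → ℝ) (f : RN N → ℝ → ℝ)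
    (u w : RN N → ℝ) : ℝ :=
  energyLHS s p u w - choquardRHS Ω μ f u w

/-- The perturbed functional `J_λ`. -/
def Jlam (Ω : Set (RN N)) (s p μ : RN N → RN N → ℝ) (f : RN N → ℝ → ℝ)
    (α : RN N → ℝ) (lam : ℝ) (u : RN N → ℝ) : ℝ :=
  Jfun Ω s p μ f u - lam * ∫ x in Ω, |u x| ^ α x / α x


/-- The integrand of the Gagliardo modular of `v`. -/
def gker (s p : RN N → RN N → ℝ) (v : RN N → ℝ) (z : RN N × RN N) : ℝ≥0∞ :=
  ENNReal.ofReal |v z.1 - v z.2| ^ p z.1 z.2 /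
    ENNReal.ofReal (dist z.1 z.2) ^ ((N : ℝ) + s z.1 z.2 * p z.1 z.2)

/-- The part of `B` on which `|v|` is at least `2 ^ k`. -/
def levelSet (v : RN N → ℝ) (B : Set (RN N)) (k : ℕ) : Set (RN N) :=
  B ∩ {x | (2 : ℝ) ^ k ≤ |v x|}

lemma levelSet_subset (v : RN N → ℝ) (B : Set (RN N)) (k : ℕ) : levelSet v B k ⊆ B :=
  inter_subset_left

/-- The measurable functions vanishing outside `Ω` whose Gagliardo modular is at most `1`. -/
structure InModularBall (Ω : Set (RN N)) (s p : RN N → RN N → ℝ) (v : RN N → ℝ) : Prop where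
  measurable : Measurable v
  ae_eq_zero : ∀ᵐ x, x ∉ Ω → v x = 0
  modular_le : gmodular univ s p v 1 ≤ 1

lemma measurableSet_levelSet {v : RN N → ℝ} (hv : Measurable v) {B : Set (RN N)}
    (hB : MeasurableSet B) (k : ℕ) : MeasurableSet (levelSet v B k) :=
  hB.inter (measurableSet_le measurable_const hv.abs)

lemma measurable_gker {s p : RN N → RN N → ℝ}
    (hs : Continuous fun z : RN N × RN N => s z.1 z.2)
    (hp : Continuous fun z : RN N × RN N => p z.1 z.2) {v : RN N → ℝ} (hv : Measurable v) :
    Measurable (gker s p v) := by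
  have hs' := hs.measurable
  have hp' := hp.measurable
  have h1 : Measurable fun z : RN N × RN N => v z.1 := hv.comp measurable_fst
  have h2 : Measurable fun z : RN N × RN N => v z.2 := hv.comp measurable_snd
  have h3 : Measurable fun z : RN N × RN N => |v z.1 - v z.2| := (h1.sub h2).abs
  unfold gker
  fun_prop

lemma gmodular_univ_one {s p : RN N → RN N → ℝ}
    (hs : Continuous fun z : RN N × RN N => s z.1 z.2)
    (hp : Continuous fun z : RN N × RN N => p z.1 z.2) {v : RN N → ℝ} (hv : Measurable v) :
    gmodular univ s p v 1 = ∫⁻ x, ∫⁻ y, gker s p v (x, y) := by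
  rw [← lintegral_prod _ (measurable_gker hs hp hv).aemeasurable]
  simp [gmodular, gker, Measure.volume_eq_prod]

/-- Markov's inequality for the double integral defining the modular. -/
lemma mul_le_gmodular {s p : RN N → RN N → ℝ}
    (hs : Continuous fun z : RN N × RN N => s z.1 z.2)
    (hp : Continuous fun z : RN N × RN N => p z.1 z.2) {v : RN N → ℝ} (hv : Measurable v)
    {A : Set (RN N)} (hA : MeasurableSet A) {c m : ℝ≥0∞}
    (h : ∀ x ∈ A, m ≤ volume {y | c ≤ gker s p v (x, y)}) :
    c * m * volume A ≤ gmodular univ s p v 1 := by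
  rw [gmodular_univ_one hs hp hv, ← setLIntegral_const]
  refine (setLIntegral_mono' hA fun x hx => ?_).trans (setLIntegral_le_lintegral _ _)
  exact (mul_le_mul_right (h x hx) c).trans (mul_meas_ge_le_lintegral
    ((measurable_gker hs hp hv).comp measurable_prodMk_left) c)

lemma le_gker {s p : RN N → RN N → ℝ} {v : RN N → ℝ} {x y : RN N} {b p₀ : ℝ} {d : ℝ≥0∞}
    (hb : 1 ≤ b) (hv : b ≤ |v x - v y|) (hp₀ : 0 ≤ p₀) (hp : p₀ ≤ p x y)
    (hd : ENNReal.ofReal (dist x y) ^ ((N : ℝ) + s x y * p x y) ≤ d) :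
    ENNReal.ofReal b ^ p₀ / d ≤ gker s p v (x, y) := by
  refine ENNReal.div_le_div ?_ hd
  calc ENNReal.ofReal b ^ p₀ ≤ ENNReal.ofReal b ^ p x y :=
        ENNReal.rpow_le_rpow_of_exponent_le (by simpa using hb) hp
    _ ≤ _ := ENNReal.rpow_le_rpow (ENNReal.ofReal_le_ofReal hv) (hp₀.trans hp)

/-- A point of a ball sees a fixed proportion of every smaller ball around it. -/
lemma exists_ball_subset {x₀ x : RN N} {R ρ : ℝ} (hρ : 0 < ρ) (hρR : ρ ≤ R)
    (hx : x ∈ Metric.ball x₀ R) :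
    ∃ z, ∀ y ∈ Metric.ball z ρ, y ∈ Metric.ball x₀ R ∧ dist x y ≤ 2 * ρ := by
  have hR : 0 < R := hρ.trans_le hρR
  have hl : ρ / R ≤ 1 := (div_le_one hR).2 hρR
  have hl0 : 0 ≤ ρ / R := by positivity
  have hlR : ρ / R * R = ρ := by field_simp
  rw [Metric.mem_ball] at hx
  refine ⟨AffineMap.lineMap x x₀ (ρ / R), fun y hy => ?_⟩
  rw [Metric.mem_ball] at hy
  have h1 : dist (AffineMap.lineMap x x₀ (ρ / R)) x₀ = (1 - ρ / R) * dist x x₀ := by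
    rw [dist_lineMap_right, Real.norm_of_nonneg (by linarith)]
  have h2 : dist x (AffineMap.lineMap x x₀ (ρ / R)) = ρ / R * dist x x₀ := by
    rw [dist_left_lineMap, Real.norm_of_nonneg hl0]
  have h3 := dist_triangle y (AffineMap.lineMap x x₀ (ρ / R)) x₀
  have h4 := dist_triangle_right x y (AffineMap.lineMap x x₀ (ρ / R))
  have h5 : (1 - ρ / R) * dist x x₀ ≤ (1 - ρ / R) * R :=
    mul_le_mul_of_nonneg_left hx.le (by linarith)
  have h6 : ρ / R * dist x x₀ ≤ ρ / R * R := mul_le_mul_of_nonneg_left hx.le hl0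
  refine ⟨?_, ?_⟩
  · rw [Metric.mem_ball]; nlinarith
  · nlinarith

lemma volume_ball_eq [NeZero N] (x : RN N) {ρ : ℝ} (hρ : 0 ≤ ρ) :
    volume (Metric.ball x ρ) =
      ENNReal.ofReal (ρ ^ N * volume.real (Metric.ball (0 : RN N) 1)) := by
  rw [Measure.addHaar_ball _ _ hρ, finrank_euclideanSpace_fin,
    ENNReal.ofReal_mul (by positivity), ofReal_measureReal measure_ball_lt_top.ne]

lemma volume_unitBall_pos : 0 < volume.real (Metric.ball (0 : RN N) 1) :=
  ENNReal.toReal_pos (Metric.measure_ball_pos _ _ one_pos).ne' measure_ball_lt_top.ne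

/-- Decay of the level sets in one dyadic step. -/
lemma volume_levelSet_succ_le [NeZero N] {s p : RN N → RN N → ℝ}
    (hs : Continuous fun z : RN N × RN N => s z.1 z.2)
    (hp : Continuous fun z : RN N × RN N => p z.1 z.2) {v : RN N → ℝ} (hv : Measurable v)
    (hmod : gmodular univ s p v 1 ≤ 1) {x₀ : RN N} {R s₀ p₀ : ℝ} (hR : 2 * R ≤ 1)
    (hR₀ : 0 < R) (hs₀ : 0 < s₀) (hp₀ : 0 < p₀)
    (hloc : ∀ x ∈ Metric.ball x₀ R, ∀ y ∈ Metric.ball x₀ R, s₀ ≤ s x y ∧ p₀ ≤ p x y)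
    {k : ℕ} {m : ℝ} (hm : 0 < m)
    (hmk : volume.real (levelSet v (Metric.ball x₀ R) k) ≤ m)
    (hmR : 2 * m ≤ volume.real (Metric.ball (0 : RN N) 1) * R ^ N) :
    volume.real (levelSet v (Metric.ball x₀ R) (k + 1)) ≤
      (2 ^ (N + 1) / volume.real (Metric.ball (0 : RN N) 1)) ^ (1 + s₀ * p₀ / N) *
        ((2 : ℝ) ^ (k * p₀))⁻¹ * m ^ (s₀ * p₀ / N) := by
  have hN : (0 : ℝ) < N := by exact_mod_cast Nat.pos_of_ne_zero (NeZero.ne N)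
  have hω := volume_unitBall_pos (N := N)
  set ω := volume.real (Metric.ball (0 : RN N) 1) with hωdef
  set B := Metric.ball x₀ R with hB
  obtain ⟨ρ, hρ, hρN⟩ : ∃ ρ : ℝ, 0 < ρ ∧ ρ ^ N * ω = 2 * m := by
    refine ⟨(2 * m / ω) ^ (N : ℝ)⁻¹, by positivity, ?_⟩
    rw [Real.rpow_inv_natCast_pow (by positivity) (NeZero.ne N)]
    field_simp
  have hρR : ρ ≤ R := by
    refine (pow_le_pow_iff_left₀ hρ.le hR₀.le (NeZero.ne N)).1 ?_
    refine le_of_mul_le_mul_right ?_ hω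
    linarith
  have hBfin : ∀ j, volume (levelSet v B j) ≠ ⊤ := fun j =>
    measure_ne_top_of_subset inter_subset_left measure_ball_lt_top.ne
  have hexp : 0 ≤ (N : ℝ) + s₀ * p₀ := by positivity
  have key := mul_le_gmodular hs hp hv
    (measurableSet_levelSet hv (B := B) measurableSet_ball (k + 1))
    (c := ENNReal.ofReal (2 ^ k) ^ p₀ / ENNReal.ofReal (2 * ρ) ^ ((N : ℝ) + s₀ * p₀))
    (m := ENNReal.ofReal m) (by
      rintro x ⟨hxB, hx⟩
      obtain ⟨z, hz⟩ := exists_ball_subset hρ hρR hxB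
      calc ENNReal.ofReal m = ENNReal.ofReal (2 * m) - ENNReal.ofReal m := by
            rw [← ENNReal.ofReal_sub _ hm.le]; congr 1; ring
        _ ≤ volume (Metric.ball z ρ) - volume (levelSet v B k) := by
            rw [volume_ball_eq _ hρ.le, ← hωdef, hρN]
            refine tsub_le_tsub_left ?_ _
            rw [← ofReal_measureReal (hBfin k)]
            exact ENNReal.ofReal_le_ofReal hmk
        _ ≤ volume (Metric.ball z ρ \ levelSet v B k) := le_measure_sdiff
        _ ≤ _ := by
            refine measure_mono fun y hy => ?_
            obtain ⟨hyB, hxy⟩ := hz y hy.1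
            obtain ⟨h1, h2⟩ := hloc x hxB y hyB
            have hyk : |v y| < 2 ^ k := not_le.1 fun h => hy.2 ⟨hyB, h⟩
            have hxk : (2 : ℝ) ^ (k + 1) ≤ |v x| := hx
            refine le_gker (one_le_pow₀ one_le_two) ?_ hp₀.le h2 ?_
            · have := abs_sub_abs_le_abs_sub (v x) (v y)
              rw [pow_succ] at hxk
              linarith
            · refine (ENNReal.rpow_le_rpow_of_exponent_ge ?_
                (add_le_add_right (mul_le_mul h1 h2 hp₀.le (hs₀.le.trans h1)) _)).trans
                (ENNReal.rpow_le_rpow (ENNReal.ofReal_le_ofReal hxy) hexp)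
              rw [ENNReal.ofReal_le_one]
              linarith)
  replace key := key.trans hmod
  rw [← ofReal_measureReal (hBfin (k + 1)), ENNReal.ofReal_rpow_of_pos (by positivity),
    ENNReal.ofReal_rpow_of_pos (by positivity), ← ENNReal.ofReal_div_of_pos (by positivity),
    ← ENNReal.ofReal_mul (by positivity), ← ENNReal.ofReal_mul (by positivity),
    ENNReal.ofReal_le_one] at key
  have e1 : ((2 : ℝ) ^ k) ^ p₀ = 2 ^ (k * p₀) := by
    rw [← Real.rpow_natCast, ← Real.rpow_mul two_pos.le]
  have e2 : (2 * ρ) ^ ((N : ℝ) + s₀ * p₀) = (2 ^ (N + 1) / ω * m) ^ (1 + s₀ * p₀ / N) := by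
    have : 2 ^ (N + 1) / ω * m = (2 * ρ) ^ (N : ℝ) := by
      rw [Real.rpow_natCast, mul_pow, div_mul_eq_mul_div, div_eq_iff hω.ne', mul_assoc, hρN]
      ring
    rw [this, ← Real.rpow_mul (by positivity)]
    congr 1
    field_simp
  rw [e1, e2, Real.mul_rpow (by positivity) hm.le, Real.rpow_add hm, Real.rpow_one] at key
  set a := volume.real (levelSet v B (k + 1))
  set C := (2 ^ (N + 1) / ω) ^ (1 + s₀ * p₀ / N)
  have hC : 0 < C := by positivity
  have hT : (0 : ℝ) < 2 ^ (k * p₀) := by positivity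
  have hM : 0 < m ^ (s₀ * p₀ / N) := by positivity
  have : 2 ^ (k * p₀) / (C * (m * m ^ (s₀ * p₀ / N))) * m * a =
      a / (C * (2 ^ (k * p₀))⁻¹ * m ^ (s₀ * p₀ / N)) := by
    field_simp
  rw [this, div_le_one (by positivity)] at key
  exact key

/-- Functions in the modular ball have uniformly small superlevel sets, because they vanish
outside a bounded set. -/
lemma exists_volume_levelSet_le [NeZero N] {Ω : Set (RN N)} (hΩm : MeasurableSet Ω)
    (hΩb : Bornology.IsBounded Ω) {s p : RN N → RN N → ℝ}
    (hs : Continuous fun z : RN N × RN N => s z.1 z.2)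
    (hp : Continuous fun z : RN N × RN N => p z.1 z.2) (hp₁ : ∀ x y, 1 ≤ p x y)
    (hsp : ∀ x y, s x y * p x y ≤ N) (hsp₀ : ∀ x y, 0 ≤ s x y * p x y) {δ : ℝ} (hδ : 0 < δ) :
    ∃ k₀ : ℕ, ∀ v, InModularBall Ω s p v → ∀ k, k₀ ≤ k → ∀ B : Set (RN N),
      volume.real (levelSet v B k) ≤ δ := by
  obtain ⟨L, hL, hΩL⟩ := hΩb.subset_ball_lt 1 0
  have hω := volume_unitBall_pos (N := N)
  set ω := volume.real (Metric.ball (0 : RN N) 1) with hωdef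
  have hL0 : 0 < L := by linarith
  obtain ⟨k₀, hk₀⟩ := pow_unbounded_of_one_lt
    ((3 * L) ^ ((N : ℝ) + N) / (ω * L ^ N) / δ) one_lt_two
  refine ⟨k₀, fun v hv k hk B => ?_⟩
  have key := mul_le_gmodular hs hp hv.measurable
    (measurableSet_levelSet hv.measurable hΩm k)
    (c := ENNReal.ofReal (2 ^ k) ^ (1 : ℝ) / ENNReal.ofReal (3 * L) ^ ((N : ℝ) + N))
    (m := ENNReal.ofReal (ω * L ^ N)) (by
      rintro x ⟨hxΩ, hx⟩
      calc ENNReal.ofReal (ω * L ^ N)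
          ≤ ENNReal.ofReal ((2 * L) ^ N * ω) - ENNReal.ofReal (L ^ N * ω) := by
            rw [← ENNReal.ofReal_sub _ (by positivity)]
            refine ENNReal.ofReal_le_ofReal ?_
            have h2 : (2 : ℝ) ≤ 2 ^ N := le_self_pow₀ one_le_two (NeZero.ne N)
            have h3 : 0 < L ^ N * ω := by positivity
            rw [mul_pow]
            nlinarith
        _ = volume (Metric.ball (0 : RN N) (2 * L)) - volume (Metric.ball (0 : RN N) L) := by
            rw [volume_ball_eq _ (by positivity), volume_ball_eq _ hL0.le]
        _ ≤ volume (Metric.ball (0 : RN N) (2 * L) \ Metric.ball (0 : RN N) L) :=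
            le_measure_sdiff
        _ ≤ _ := by
            refine measure_mono_ae ?_
            filter_upwards [hv.ae_eq_zero] with y hy0 hy
            have hvy : v y = 0 := hy0 fun h => hy.2 (hΩL h)
            have hxy : dist x y ≤ 3 * L := by
              have h1 := Metric.mem_ball.1 (hΩL hxΩ)
              have h2 := Metric.mem_ball.1 hy.1
              have h3 := dist_triangle_right x y 0
              linarith
            refine le_gker (one_le_pow₀ one_le_two) ?_ zero_le_one (hp₁ x y) ?_
            · rw [hvy, sub_zero]
              exact hx
            · refine (ENNReal.rpow_le_rpow (ENNReal.ofReal_le_ofReal hxy) ?_).trans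
                (ENNReal.rpow_le_rpow_of_exponent_le ?_ (add_le_add_right (hsp x y) _))
              · have := hsp₀ x y
                positivity
              · rw [ENNReal.one_le_ofReal]
                linarith)
  have hsub : volume (levelSet v B k) ≤ volume (levelSet v Ω k) := by
    refine measure_mono_ae ?_
    filter_upwards [hv.ae_eq_zero] with y hy0 hy
    have hyk : (2 : ℝ) ^ k ≤ |v y| := hy.2
    refine ⟨by_contra fun h => ?_, hyk⟩
    rw [hy0 h, abs_zero] at hyk
    exact absurd hyk (not_le.2 (by positivity))
  have hfin : volume (levelSet v Ω k) ≠ ⊤ :=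
    measure_ne_top_of_subset (inter_subset_left.trans hΩL) measure_ball_lt_top.ne
  refine (ENNReal.toReal_mono hfin hsub).trans ?_
  change volume.real (levelSet v Ω k) ≤ δ
  replace key := key.trans hv.modular_le
  rw [← ofReal_measureReal hfin, ENNReal.rpow_one,
    ENNReal.ofReal_rpow_of_pos (by positivity), ← ENNReal.ofReal_div_of_pos (by positivity),
    ← ENNReal.ofReal_mul (by positivity), ← ENNReal.ofReal_mul (by positivity),
    ENNReal.ofReal_le_one] at key
  have hkk : (2 : ℝ) ^ k₀ ≤ 2 ^ k := pow_le_pow_right₀ one_le_two hk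
  have hD : 0 < (3 * L) ^ ((N : ℝ) + N) := by positivity
  have h1 := hk₀.trans_le hkk
  rw [div_lt_iff₀ hδ, div_lt_iff₀ (by positivity)] at h1
  rw [div_mul_eq_mul_div, div_mul_eq_mul_div, div_le_one hD] at key
  by_contra! hlt
  have h2 : 2 ^ k * (ω * L ^ N) * δ < 2 ^ k * (ω * L ^ N) * volume.real (levelSet v Ω k) :=
    mul_lt_mul_of_pos_left hlt (by positivity)
  nlinarith

/-- Weak-type fractional Sobolev inequality on a small ball. -/
lemma exists_weak_type_bound [NeZero N] {Ω : Set (RN N)} (hΩm : MeasurableSet Ω)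
    (hΩb : Bornology.IsBounded Ω) {s p : RN N → RN N → ℝ}
    (hs : Continuous fun z : RN N × RN N => s z.1 z.2)
    (hp : Continuous fun z : RN N × RN N => p z.1 z.2) (hp₁ : ∀ x y, 1 ≤ p x y)
    (hsp : ∀ x y, s x y * p x y ≤ N) (hsp₀ : ∀ x y, 0 ≤ s x y * p x y)
    {x₀ : RN N} {R s₀ p₀ : ℝ} (hR : 2 * R ≤ 1)
    (hR₀ : 0 < R) (hs₀ : 0 < s₀) (hp₀ : 0 < p₀) (hθ : s₀ * p₀ / N < 1)
    (hloc : ∀ x ∈ Metric.ball x₀ R, ∀ y ∈ Metric.ball x₀ R, s₀ ≤ s x y ∧ p₀ ≤ p x y) :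
    ∃ K : ℝ, ∀ v, InModularBall Ω s p v → ∀ k : ℕ,
      volume.real (levelSet v (Metric.ball x₀ R) k) ≤
        K * ((2 : ℝ) ^ (k * (p₀ / (1 - s₀ * p₀ / N))))⁻¹ := by
  have hN : (0 : ℝ) < N := by exact_mod_cast Nat.pos_of_ne_zero (NeZero.ne N)
  have hω := volume_unitBall_pos (N := N)
  set ω := volume.real (Metric.ball (0 : RN N) 1) with hωdef
  set B := Metric.ball x₀ R with hB
  set θ := s₀ * p₀ / N with hθdef
  have hθ₀ : 0 < θ := by positivity
  have h1θ : 0 < 1 - θ := by linarith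
  set τ := p₀ / (1 - θ) with hτdef
  have hτ₀ : 0 < τ := by positivity
  have hτ : p₀ + τ * θ = τ := by
    have : τ * (1 - θ) = p₀ := div_mul_cancel₀ _ h1θ.ne'
    linarith
  set δ := ω * R ^ N / 2 with hδdef
  have hδ : 0 < δ := by positivity
  obtain ⟨k₀, hk₀⟩ := exists_volume_levelSet_le hΩm hΩb hs hp hp₁ hsp hsp₀ hδ
  set C := (2 ^ (N + 1) / ω) ^ (1 + θ) with hCdef
  have hC : 0 < C := by positivity
  set K₁ := (C * 2 ^ τ) ^ (1 - θ)⁻¹ with hK₁def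
  have hK₁ : 0 < K₁ := by positivity
  set K := max K₁ (volume.real B * 2 ^ (k₀ * τ)) with hKdef
  have hK : 0 < K := hK₁.trans_le (le_max_left _ _)
  have hKC : C * 2 ^ τ * K ^ θ ≤ K := by
    have h1 : C * 2 ^ τ ≤ K ^ (1 - θ) := by
      calc C * 2 ^ τ = K₁ ^ (1 - θ) := by
            rw [hK₁def, ← Real.rpow_mul (by positivity), inv_mul_cancel₀ h1θ.ne', Real.rpow_one]
        _ ≤ K ^ (1 - θ) := Real.rpow_le_rpow hK₁.le (le_max_left _ _) h1θ.le
    calc C * 2 ^ τ * K ^ θ ≤ K ^ (1 - θ) * K ^ θ := by gcongr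
      _ = K := by rw [← Real.rpow_add hK, sub_add_cancel, Real.rpow_one]
  refine ⟨K, fun v hv k => ?_⟩
  have htriv : ∀ j : ℕ, j ≤ k₀ → volume.real (levelSet v B j) ≤ K * ((2 : ℝ) ^ (j * τ))⁻¹ := by
    intro j hj
    rw [← div_eq_mul_inv, le_div_iff₀ (by positivity)]
    refine le_trans ?_ (le_max_right _ _)
    refine mul_le_mul (measureReal_mono inter_subset_left measure_ball_lt_top.ne) ?_
      (by positivity) (by positivity)
    refine Real.rpow_le_rpow_of_exponent_le one_le_two ?_
    gcongr
  induction k with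
  | zero => exact htriv 0 (Nat.zero_le _)
  | succ k ih =>
    rcases Nat.lt_or_ge k k₀ with hk | hk
    · exact htriv _ hk
    · have hm : 0 < min (K * ((2 : ℝ) ^ (k * τ))⁻¹) δ := lt_min (by positivity) hδ
      have hstep := volume_levelSet_succ_le hs hp hv.measurable hv.modular_le hR hR₀ hs₀ hp₀ hloc
        hm (le_min ih (hk₀ v hv k hk B)) (by
          have := min_le_right (K * ((2 : ℝ) ^ (k * τ))⁻¹) δ
          linarith)
      refine hstep.trans ?_
      calc C * ((2 : ℝ) ^ (k * p₀))⁻¹ * (min (K * ((2 : ℝ) ^ (k * τ))⁻¹) δ) ^ θ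
          ≤ C * ((2 : ℝ) ^ (k * p₀))⁻¹ * (K * ((2 : ℝ) ^ (k * τ))⁻¹) ^ θ := by
            gcongr
            exact min_le_left _ _
        _ = C * 2 ^ τ * K ^ θ * ((2 : ℝ) ^ (((k + 1 : ℕ) : ℝ) * τ))⁻¹ := by
            rw [Real.mul_rpow hK.le (by positivity), ← Real.rpow_neg two_pos.le,
              ← Real.rpow_neg two_pos.le, ← Real.rpow_neg two_pos.le,
              ← Real.rpow_mul two_pos.le]
            have : (2 : ℝ) ^ (-(k * p₀)) * 2 ^ (-(k * τ) * θ) =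
                2 ^ τ * 2 ^ (-(((k + 1 : ℕ) : ℝ) * τ)) := by
              rw [← Real.rpow_add two_pos, ← Real.rpow_add two_pos]
              congr 1
              push_cast
              linear_combination (-(k : ℝ)) * hτ
            linear_combination C * K ^ θ * this
        _ ≤ _ := by gcongr

/-- A weak-type bound for the exponent `τ` gives a strong-type bound for smaller exponents. -/
lemma lintegral_rpow_le_of_levelSet {v : RN N → ℝ} (hv : Measurable v) {B : Set (RN N)}
    (hB : MeasurableSet B) (hBfin : volume B ≠ ⊤) {K b τ : ℝ} (hb : 0 ≤ b)
    (hK : ∀ k : ℕ, volume.real (levelSet v B k) ≤ K * ((2 : ℝ) ^ (k * τ))⁻¹) :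
    ∫⁻ x in B, ENNReal.ofReal |v x| ^ b ≤
      volume B + ∑' k : ℕ, ENNReal.ofReal (2 ^ b * K * (2 ^ (b - τ)) ^ k) := by
  have hpt : ∀ x ∈ B, ENNReal.ofReal |v x| ^ b ≤
      1 + ∑' k : ℕ, (levelSet v B k).indicator
        (fun _ => ENNReal.ofReal (2 ^ ((k + 1 : ℝ) * b))) x := by
    intro x hx
    rcases le_total |v x| 1 with h1 | h1
    · exact (ENNReal.rpow_le_one (ENNReal.ofReal_le_one.2 h1) hb).trans le_self_add
    · obtain ⟨n, hn, hn'⟩ := exists_nat_pow_near h1 one_lt_two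
      refine le_trans ?_ ((ENNReal.le_tsum n).trans le_add_self)
      rw [indicator_of_mem (show x ∈ levelSet v B n from ⟨hx, hn⟩),
        ENNReal.ofReal_rpow_of_nonneg (abs_nonneg _) hb]
      refine ENNReal.ofReal_le_ofReal ((Real.rpow_le_rpow (abs_nonneg _) hn'.le hb).trans_eq ?_)
      rw [← Real.rpow_natCast, ← Real.rpow_mul two_pos.le]
      push_cast
      rfl
  calc ∫⁻ x in B, ENNReal.ofReal |v x| ^ b
      ≤ ∫⁻ x in B, (1 + ∑' k : ℕ, (levelSet v B k).indicator
        (fun _ => ENNReal.ofReal (2 ^ ((k + 1 : ℝ) * b))) x) := setLIntegral_mono' hB hpt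
    _ = volume B + ∑' k : ℕ, ENNReal.ofReal (2 ^ ((k + 1 : ℝ) * b)) *
          volume (levelSet v B k) := by
        rw [lintegral_add_left measurable_const, setLIntegral_one, lintegral_tsum fun k =>
          (measurable_const.indicator (measurableSet_levelSet hv hB k)).aemeasurable]
        congr 1
        refine tsum_congr fun k => ?_
        rw [lintegral_indicator_const (measurableSet_levelSet hv hB k),
          Measure.restrict_apply (measurableSet_levelSet hv hB k),
          inter_eq_left.2 (levelSet_subset v B k)]
    _ ≤ _ := by
        gcongr with k
        rw [← ofReal_measureReal (measure_ne_top_of_subset (levelSet_subset v B k) hBfin),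
          ← ENNReal.ofReal_mul (by positivity)]
        refine ENNReal.ofReal_le_ofReal ((mul_le_mul_of_nonneg_left (hK k)
          (by positivity)).trans_eq ?_)
        rw [← Real.rpow_natCast, ← Real.rpow_mul two_pos.le, ← Real.rpow_neg two_pos.le]
        have : (2 : ℝ) ^ ((k + 1 : ℝ) * b) * 2 ^ (-(k * τ)) = 2 ^ b * 2 ^ ((b - τ) * k) := by
          rw [← Real.rpow_add two_pos, ← Real.rpow_add two_pos]
          congr 1
          ring
        linear_combination K * this

/-- Local fractional Sobolev inequality for a subcritical variable exponent. -/
lemma exists_nhds_lintegral_rpow_le [NeZero N] {Ω : Set (RN N)} (hΩm : MeasurableSet Ω)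
    (hΩb : Bornology.IsBounded Ω) {s p : RN N → RN N → ℝ}
    (hs : Continuous fun z : RN N × RN N => s z.1 z.2)
    (hp : Continuous fun z : RN N × RN N => p z.1 z.2) (hp₁ : ∀ x y, 1 ≤ p x y)
    (hs₀ : ∀ x y, 0 < s x y) (hsp : ∀ x y, s x y * p x y < N) {γ : RN N → ℝ}
    (hγ : Continuous γ) (hγ₀ : ∀ x, 0 ≤ γ x) {x₀ : RN N} (hγx : γ x₀ < pstar s p x₀) :
    ∃ U ∈ nhds x₀, ∃ C : ℝ≥0∞, C ≠ ⊤ ∧ ∀ v, InModularBall Ω s p v →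
      ∫⁻ x in U, ENNReal.ofReal |v x| ^ γ x ≤ C := by
  have hN : (0 : ℝ) < N := by exact_mod_cast Nat.pos_of_ne_zero (NeZero.ne N)
  have hp₀ : ∀ x y, 0 < p x y := fun x y => one_pos.trans_le (hp₁ x y)
  have hstar : pstar s p x₀ = p x₀ x₀ / (1 - s x₀ x₀ * p x₀ x₀ / N) := by
    have := hsp x₀ x₀
    rw [pstar, div_eq_div_iff (by linarith)
      (by rw [sub_ne_zero, ne_comm, Ne, div_eq_one_iff_eq hN.ne']; exact this.ne)]
    field_simp
  have hden : (1 - (s x₀ x₀ - 0) * (p x₀ x₀ - 0) / N) ≠ 0 := by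
    rw [sub_zero, sub_zero, sub_ne_zero, ne_comm, Ne, div_eq_one_iff_eq hN.ne']
    exact (hsp x₀ x₀).ne
  have hcont : ContinuousAt
      (fun ε : ℝ => (p x₀ x₀ - ε) / (1 - (s x₀ x₀ - ε) * (p x₀ x₀ - ε) / N)) 0 := by
    refine ContinuousAt.div (by fun_prop) (by fun_prop) hden
  have hev : ∀ᶠ ε : ℝ in nhdsWithin 0 (Ioi 0),
      γ x₀ < (p x₀ x₀ - ε) / (1 - (s x₀ x₀ - ε) * (p x₀ x₀ - ε) / N) ∧
        ε < p x₀ x₀ ∧ ε < s x₀ x₀ ∧ 0 < ε := by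
    have h1 := hcont.eventually_const_lt (u := γ x₀) (by simpa [hstar] using hγx)
    have h2 := eventually_lt_nhds (hp₀ x₀ x₀)
    have h3 := eventually_lt_nhds (hs₀ x₀ x₀)
    filter_upwards [nhdsWithin_le_nhds h1, nhdsWithin_le_nhds h2, nhdsWithin_le_nhds h3,
      self_mem_nhdsWithin] with ε a b c d using ⟨a, b, c, d⟩
  obtain ⟨ε, hε1, hεp, hεs, hε⟩ := hev.exists
  obtain ⟨b, hb1, hb2⟩ := exists_between hε1
  have hb0 : 0 ≤ b := (hγ₀ x₀).trans hb1.le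
  have hloc : ∀ᶠ z : RN N × RN N in nhds (x₀, x₀),
      s x₀ x₀ - ε ≤ s z.1 z.2 ∧ p x₀ x₀ - ε ≤ p z.1 z.2 := by
    have h1 := (hs.continuousAt (x := (x₀, x₀))).eventually_const_lt
      (u := s x₀ x₀ - ε) (by simpa using hε)
    have h2 := (hp.continuousAt (x := (x₀, x₀))).eventually_const_lt
      (u := p x₀ x₀ - ε) (by simpa using hε)
    filter_upwards [h1, h2] with z a b using ⟨a.le, b.le⟩
  obtain ⟨R₁, hR₁, hball⟩ := Metric.eventually_nhds_iff_ball.1 hloc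
  obtain ⟨R₂, hR₂, hball₂⟩ := Metric.eventually_nhds_iff_ball.1
    (hγ.continuousAt.eventually_lt_const hb1)
  set R := min (1 / 2) (min R₁ R₂)
  have hR : 0 < R := lt_min (by norm_num) (lt_min hR₁ hR₂)
  have hRhalf : R ≤ 1 / 2 := min_le_left _ _
  have hRR₁ : R ≤ R₁ := (min_le_right _ _).trans (min_le_left _ _)
  have hRR₂ : R ≤ R₂ := (min_le_right _ _).trans (min_le_right _ _)
  have hθ : (s x₀ x₀ - ε) * (p x₀ x₀ - ε) / N < 1 := by
    rw [div_lt_one hN]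
    refine lt_of_le_of_lt ?_ (hsp x₀ x₀)
    exact mul_le_mul (by linarith) (by linarith) (by linarith) (hs₀ _ _).le
  obtain ⟨K, hK⟩ := exists_weak_type_bound hΩm hΩb hs hp hp₁ (fun x y => (hsp x y).le)
    (fun x y => (mul_pos (hs₀ x y) (hp₀ x y)).le) (x₀ := x₀) (R := R) (by linarith) hR
    (sub_pos.2 hεs) (sub_pos.2 hεp) hθ fun x hx y hy => by
      refine hball (x, y) ?_
      rw [← ball_prod_same]
      exact ⟨Metric.ball_subset_ball hRR₁ hx, Metric.ball_subset_ball hRR₁ hy⟩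
  set τ := (p x₀ x₀ - ε) / (1 - (s x₀ x₀ - ε) * (p x₀ x₀ - ε) / N)
  have hsum : Summable fun k : ℕ => 2 ^ b * K * ((2 : ℝ) ^ (b - τ)) ^ k := by
    refine (summable_geometric_of_lt_one (by positivity) ?_).mul_left _
    exact Real.rpow_lt_one_of_one_lt_of_neg one_lt_two (sub_neg.2 hb2)
  refine ⟨Metric.ball x₀ R, Metric.ball_mem_nhds _ hR,
    volume (Metric.ball x₀ R) + (volume (Metric.ball x₀ R) +
      ∑' k : ℕ, ENNReal.ofReal (2 ^ b * K * (2 ^ (b - τ)) ^ k)),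
    ENNReal.add_ne_top.2 ⟨measure_ball_lt_top.ne, ENNReal.add_ne_top.2
      ⟨measure_ball_lt_top.ne, hsum.tsum_ofReal_ne_top⟩⟩, fun v hv => ?_⟩
  calc ∫⁻ x in Metric.ball x₀ R, ENNReal.ofReal |v x| ^ γ x
      ≤ ∫⁻ x in Metric.ball x₀ R, (1 + ENNReal.ofReal |v x| ^ b) := by
        refine setLIntegral_mono' measurableSet_ball fun x hx => ?_
        rcases le_total (ENNReal.ofReal |v x|) 1 with h | h
        · exact (ENNReal.rpow_le_one h (hγ₀ x)).trans le_self_add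
        · exact (ENNReal.rpow_le_rpow_of_exponent_le h
            (hball₂ x (Metric.ball_subset_ball hRR₂ hx)).le).trans le_add_self
    _ = volume (Metric.ball x₀ R) + ∫⁻ x in Metric.ball x₀ R, ENNReal.ofReal |v x| ^ b := by
        rw [lintegral_add_left measurable_const, setLIntegral_one]
    _ ≤ _ := by
        gcongr
        exact lintegral_rpow_le_of_levelSet hv.measurable measurableSet_ball
          measure_ball_lt_top.ne hb0 (hK v hv)

/-- Fractional Sobolev inequality on `Ω` for a subcritical variable exponent. -/
lemma exists_lintegral_rpow_le [NeZero N] {Ω : Set (RN N)} (hΩm : MeasurableSet Ω)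
    (hΩb : Bornology.IsBounded Ω) {s p : RN N → RN N → ℝ}
    (hs : Continuous fun z : RN N × RN N => s z.1 z.2)
    (hp : Continuous fun z : RN N × RN N => p z.1 z.2) (hp₁ : ∀ x y, 1 ≤ p x y)
    (hs₀ : ∀ x y, 0 < s x y) (hsp : ∀ x y, s x y * p x y < N) {γ : RN N → ℝ}
    (hγ : Continuous γ) (hγ₀ : ∀ x, 0 ≤ γ x) (hγp : ∀ x ∈ closure Ω, γ x < pstar s p x) :
    ∃ C : ℝ≥0∞, C ≠ ⊤ ∧ ∀ v, InModularBall Ω s p v →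
      ∫⁻ x in Ω, ENNReal.ofReal |v x| ^ γ x ≤ C := by
  suffices h : ∃ C : ℝ≥0∞, C ≠ ⊤ ∧ ∀ v, InModularBall Ω s p v →
      ∫⁻ x in closure Ω, ENNReal.ofReal |v x| ^ γ x ≤ C by
    obtain ⟨C, hC, h⟩ := h
    exact ⟨C, hC, fun v hv => (lintegral_mono_set subset_closure).trans (h v hv)⟩
  refine hΩb.isCompact_closure.induction_on (p := fun S => ∃ C : ℝ≥0∞, C ≠ ⊤ ∧
    ∀ v, InModularBall Ω s p v → ∫⁻ x in S, ENNReal.ofReal |v x| ^ γ x ≤ C)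
    ⟨0, by simp, by simp⟩ ?_ ?_ ?_
  · rintro S T hST ⟨C, hC, h⟩
    exact ⟨C, hC, fun v hv => (lintegral_mono_set hST).trans (h v hv)⟩
  · rintro S T ⟨C, hC, h⟩ ⟨D, hD, h'⟩
    exact ⟨C + D, ENNReal.add_ne_top.2 ⟨hC, hD⟩, fun v hv =>
      (lintegral_union_le _ _ _).trans (add_le_add (h v hv) (h' v hv))⟩
  · intro x hx
    obtain ⟨U, hU, h⟩ := exists_nhds_lintegral_rpow_le hΩm hΩb hs hp hp₁ hs₀ hsp hγ hγ₀
      (hγp x hx)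
    exact ⟨U, mem_nhdsWithin_of_mem_nhds hU, h⟩

lemma mul_mul_le_of_lt_two {a : ℝ} (ha₁ : 1 < a) (ha₂ : a < 2) (w₁ w₂ k : ℝ≥0∞) :
    w₁ * w₂ * k ≤ w₁ ^ a * w₂ ^ a + w₁ ^ a * k ^ (2 - 2 / a)⁻¹ + w₂ ^ a * k ^ (2 - 2 / a)⁻¹ := by
  have ha : 0 < a := by linarith
  have ha' : a ≠ 0 := ha.ne'
  have ha1 : a - 1 ≠ 0 := by linarith
  have hβ : 0 < 1 - 1 / a := by rw [sub_pos, div_lt_one ha]; exact ha₁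
  have hα : 0 < 2 / a - 1 := by rw [sub_pos, lt_div_iff₀ ha]; linarith
  have ht : (2 - 2 / a)⁻¹ * (1 - 1 / a) = 1 / 2 := by
    field_simp
  set t := (2 - 2 / a)⁻¹ with htdef
  set S := w₁ ^ a * w₂ ^ a + w₁ ^ a * k ^ t + w₂ ^ a * k ^ t with hS
  have hw : ∀ w : ℝ≥0∞, w ^ (a * (2 / a - 1)) * w ^ (a * (1 - 1 / a)) = w := fun w => by
    rw [← ENNReal.rpow_add_of_nonneg _ _ (by positivity) (by positivity)]
    convert ENNReal.rpow_one w using 2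
    field_simp
    ring
  have hk : k ^ (t * (1 - 1 / a)) * k ^ (t * (1 - 1 / a)) = k := by
    rw [ht, ← ENNReal.rpow_add_of_nonneg _ _ (by norm_num) (by norm_num)]
    norm_num
  have hprod : (w₁ ^ a * w₂ ^ a) ^ (2 / a - 1) * (w₁ ^ a * k ^ t) ^ (1 - 1 / a) *
      (w₂ ^ a * k ^ t) ^ (1 - 1 / a) = w₁ * w₂ * k := by
    simp only [ENNReal.mul_rpow_of_nonneg _ _ hα.le, ENNReal.mul_rpow_of_nonneg _ _ hβ.le,
      ← ENNReal.rpow_mul]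
    calc _ = (w₁ ^ (a * (2 / a - 1)) * w₁ ^ (a * (1 - 1 / a))) *
          (w₂ ^ (a * (2 / a - 1)) * w₂ ^ (a * (1 - 1 / a))) *
          (k ^ (t * (1 - 1 / a)) * k ^ (t * (1 - 1 / a))) := by ring
      _ = _ := by rw [hw, hw, hk]
  calc w₁ * w₂ * k = _ := hprod.symm
    _ ≤ S ^ (2 / a - 1) * S ^ (1 - 1 / a) * S ^ (1 - 1 / a) := by
        refine mul_le_mul' (mul_le_mul' (ENNReal.rpow_le_rpow ?_ hα.le)
          (ENNReal.rpow_le_rpow ?_ hβ.le)) (ENNReal.rpow_le_rpow ?_ hβ.le)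
        · rw [hS, add_assoc]; exact le_self_add
        · rw [hS, add_right_comm]; exact le_add_self
        · exact le_add_self
    _ = S := by
        rw [← ENNReal.rpow_add_of_nonneg _ _ hα.le hβ.le,
          ← ENNReal.rpow_add_of_nonneg _ _ (by positivity) hβ.le]
        convert ENNReal.rpow_one S using 2
        field_simp
        ring

/-- Subcritical Hardy–Littlewood–Sobolev inequality: a symmetric kernel with a uniformly
bounded `L^t` norm pairs functions in `L^a` when `2 / a + 1 / t = 2`. -/
lemma lintegral_lintegral_mul_kernel_le {α : Type*} [MeasurableSpace α] {ν : Measure α}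
    [SFinite ν] {a : ℝ} (ha₁ : 1 < a) (ha₂ : a < 2) {w : α → ℝ≥0∞} (hw : Measurable w)
    {k : α → α → ℝ≥0∞} (hk : Measurable (Function.uncurry k)) (hsymm : ∀ x y, k x y = k y x)
    {C G : ℝ≥0∞} (hC : ∫⁻ x, w x ^ a ∂ν ≤ C)
    (hG : ∀ᵐ x ∂ν, ∫⁻ y, k x y ^ (2 - 2 / a)⁻¹ ∂ν ≤ G) :
    ∫⁻ x, ∫⁻ y, w x * w y * k x y ∂ν ∂ν ≤ C * C + C * G + C * G := by
  set t := (2 - 2 / a)⁻¹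
  have hwa : Measurable fun x => w x ^ a := hw.pow_const a
  have hkt : Measurable fun z : α × α => k z.1 z.2 ^ t := Measurable.pow_const hk t
  have hkx : ∀ x, Measurable fun y => k x y ^ t := fun x => hkt.comp measurable_prodMk_left
  have h2 : ∫⁻ x, ∫⁻ y, w x ^ a * k x y ^ t ∂ν ∂ν ≤ C * G := by
    calc ∫⁻ x, ∫⁻ y, w x ^ a * k x y ^ t ∂ν ∂ν ≤ ∫⁻ x, w x ^ a * G ∂ν := by
          refine lintegral_mono_ae ?_
          filter_upwards [hG] with x hx
          rw [lintegral_const_mul _ (hkx x)]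
          gcongr
      _ = (∫⁻ x, w x ^ a ∂ν) * G := lintegral_mul_const _ hwa
      _ ≤ C * G := by gcongr
  have h3 : ∫⁻ x, ∫⁻ y, w y ^ a * k x y ^ t ∂ν ∂ν ≤ C * G := by
    rw [lintegral_lintegral_swap]
    · simpa only [hsymm] using h2
    · exact ((hwa.comp measurable_snd).mul hkt).aemeasurable
  have h1 : ∫⁻ x, ∫⁻ y, w x ^ a * w y ^ a ∂ν ∂ν ≤ C * C := by
    simp_rw [lintegral_const_mul _ hwa]
    rw [lintegral_mul_const _ hwa]
    gcongr
  calc ∫⁻ x, ∫⁻ y, w x * w y * k x y ∂ν ∂ν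
      ≤ ∫⁻ x, ∫⁻ y, (w x ^ a * w y ^ a + w x ^ a * k x y ^ t + w y ^ a * k x y ^ t) ∂ν ∂ν :=
        lintegral_mono fun x => lintegral_mono fun y => mul_mul_le_of_lt_two ha₁ ha₂ _ _ _
    _ = ∫⁻ x, ∫⁻ y, w x ^ a * w y ^ a ∂ν ∂ν + ∫⁻ x, ∫⁻ y, w x ^ a * k x y ^ t ∂ν ∂ν +
          ∫⁻ x, ∫⁻ y, w y ^ a * k x y ^ t ∂ν ∂ν := by
        have hm1 : Measurable fun z : α × α => w z.1 ^ a * w z.2 ^ a :=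
          (hwa.comp measurable_fst).mul (hwa.comp measurable_snd)
        have hm2 : Measurable fun z : α × α => w z.1 ^ a * k z.1 z.2 ^ t :=
          (hwa.comp measurable_fst).mul hkt
        have hi1 : Measurable fun x => ∫⁻ y, w x ^ a * w y ^ a ∂ν := hm1.lintegral_prod_right'
        have hi2 : Measurable fun x => ∫⁻ y, w x ^ a * k x y ^ t ∂ν := hm2.lintegral_prod_right'
        have hi : Measurable fun x =>
            ∫⁻ y, w x ^ a * w y ^ a ∂ν + ∫⁻ y, w x ^ a * k x y ^ t ∂ν :=
          hi1.add hi2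
        rw [← lintegral_add_left hi1, ← lintegral_add_left hi]
        refine lintegral_congr fun x => ?_
        have hx1 : Measurable fun y => w x ^ a * w y ^ a := measurable_const.mul hwa
        have hx2 : Measurable fun y => w x ^ a * w y ^ a + w x ^ a * k x y ^ t :=
          hx1.add (measurable_const.mul (hkx x))
        rw [← lintegral_add_left hx1, ← lintegral_add_left hx2]
    _ ≤ _ := add_le_add (add_le_add h1 h2) h3

lemma lintegral_dist_rpow_neg_le [NeZero N] {α R : ℝ} (hα : α < N) :
    ∃ G : ℝ≥0∞, G ≠ ⊤ ∧ ∀ x : RN N,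
      ∫⁻ y in Metric.ball x R, ENNReal.ofReal (dist x y) ^ (-α) ≤ G := by
  have hint : IntegrableOn (fun y : RN N => ‖y‖ ^ (-α)) (Metric.ball 0 R) := by
    refine integrableOn_ball_of_norm_le_rpow (C := 1) (α := α) ?_ ?_ ?_ ?_
    · rw [finrank_euclideanSpace_fin]
      exact NeZero.one_le
    · rwa [finrank_euclideanSpace_fin]
    · refine Eventually.of_forall fun y => ?_
      rw [Real.norm_of_nonneg (by positivity), one_mul]
    · exact (measurable_norm.pow_const _).aestronglyMeasurable
  refine ⟨∫⁻ y in Metric.ball (0 : RN N) R, ENNReal.ofReal (‖y‖ ^ (-α)),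
    hint.lintegral_lt_top.ne, fun x => le_of_eq ?_⟩
  rw [← lintegral_indicator measurableSet_ball, ← lintegral_indicator measurableSet_ball,
    ← lintegral_sub_right_eq_self ((Metric.ball (0 : RN N) R).indicator _) x]
  refine lintegral_congr_ae ?_
  filter_upwards [Measure.ae_ne volume x] with y hy
  have hmem : y ∈ Metric.ball x R ↔ y - x ∈ Metric.ball 0 R := by
    rw [Metric.mem_ball, mem_ball_zero_iff, dist_eq_norm]
  by_cases h : y ∈ Metric.ball x R
  · rw [indicator_of_mem h, indicator_of_mem (hmem.1 h), dist_comm, dist_eq_norm,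
      ENNReal.ofReal_rpow_of_pos (norm_pos_iff.2 (sub_ne_zero.2 hy))]
  · rw [indicator_of_notMem h, indicator_of_notMem (mt hmem.2 h)]

lemma abs_Fant_le {Ω : Set (RN N)} {f : RN N → ℝ → ℝ} {M : ℝ} {r : RN N → ℝ}
    (hf : F1 Ω f M r) {x : RN N} (hx : x ∈ Ω) (hr : 1 < r x) (t : ℝ) :
    |Fant f x t| ≤ M * |t| ^ r x := by
  have h := intervalIntegral.norm_integral_le_of_norm_le_const (a := 0) (b := t) (f := f x)
    (C := M * |t| ^ (r x - 1)) fun τ hτ => by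
      refine (hf.2 x hx τ).trans ?_
      have hτt : |τ| ≤ |t| := by
        rcases mem_uIoc.1 hτ with h | h
        · rw [abs_of_pos h.1, abs_of_pos (h.1.trans_le h.2)]
          exact h.2
        · rw [abs_of_nonpos h.2, abs_of_nonpos (h.1.le.trans h.2)]
          linarith
      have := hf.1
      have : 0 ≤ r x - 1 := by linarith
      gcongr
  refine h.trans_eq ?_
  rw [sub_zero, mul_assoc]
  rcases eq_or_ne t 0 with rfl | ht
  · simp [Real.zero_rpow (show r x ≠ 0 by linarith)]
  · rw [← Real.rpow_add_one (abs_ne_zero.2 ht), sub_add_cancel]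

lemma ofReal_one_div_rpow_le {d D μ ν : ℝ} (hd : 0 ≤ d) (hdD : d ≤ D) (hD : 1 ≤ D) (hμ : 0 < μ)
    (hμν : μ ≤ ν) :
    ENNReal.ofReal (1 / d ^ μ) ≤ ENNReal.ofReal (D ^ ν) * ENNReal.ofReal d ^ (-ν) := by
  rcases hd.eq_or_lt with rfl | hd
  · simp [Real.zero_rpow hμ.ne']
  · rw [ENNReal.ofReal_rpow_of_pos hd, ← ENNReal.ofReal_mul (by positivity)]
    refine ENNReal.ofReal_le_ofReal ?_
    rw [Real.rpow_neg hd.le, ← div_eq_mul_inv, div_le_div_iff₀ (by positivity) (by positivity),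
      one_mul]
    calc d ^ ν = d ^ (ν - μ) * d ^ μ := by rw [← Real.rpow_add hd, sub_add_cancel]
      _ ≤ D ^ (ν - μ) * d ^ μ := by
        have : 0 ≤ ν - μ := by linarith
        gcongr
      _ ≤ D ^ ν * d ^ μ := by
        gcongr
        linarith

lemma gmodular_one_div {s p : RN N → RN N → ℝ} {u : RN N → ℝ} {l : ℝ} (hl : 0 < l) :
    gmodular univ s p (fun x => u x / l) 1 = gmodular univ s p u l := by
  unfold gmodular
  simp only [← sub_div, abs_div, abs_of_pos hl, div_one]

lemma gmodular_mul_le {s p : RN N → RN N → ℝ} (hp₁ : ∀ x y, 1 ≤ p x y) {u : RN N → ℝ} {l T : ℝ}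
    (hT : 1 ≤ T) (A : Set (RN N × RN N)) :
    gmodular A s p u (l * T) ≤ ENNReal.ofReal T⁻¹ * gmodular A s p u l := by
  unfold gmodular
  rw [← lintegral_const_mul' _ _ ENNReal.ofReal_ne_top]
  refine lintegral_mono fun z => ?_
  have hT0 : 0 < T := by linarith
  rw [← div_div, div_eq_mul_inv (_ / l), mul_comm (_ / l), ENNReal.ofReal_mul (by positivity),
    ENNReal.mul_rpow_of_nonneg _ _ (zero_le_one.trans (hp₁ _ _)), mul_div_assoc]
  gcongr
  calc ENNReal.ofReal T⁻¹ ^ p z.1 z.2 ≤ ENNReal.ofReal T⁻¹ ^ (1 : ℝ) :=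
        ENNReal.rpow_le_rpow_of_exponent_ge
          (ENNReal.ofReal_le_one.2 (inv_le_one_of_one_le₀ hT)) (hp₁ _ _)
    _ = _ := ENNReal.rpow_one _

lemma gmodular_univ_le_Qset {Ω : Set (RN N)} {s p : RN N → RN N → ℝ}
    (hp₁ : ∀ x y, 1 ≤ p x y) {u : RN N → ℝ} (hu : ∀ᵐ x, x ∉ Ω → u x = 0) (l : ℝ) :
    gmodular univ s p u l ≤ gmodular (Qset Ω) s p u l := by
  unfold gmodular
  rw [setLIntegral_univ]
  refine le_trans (lintegral_mono_ae ?_) (lintegral_indicator_le _ (Qset Ω))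
  have h1 : ∀ᵐ z : RN N × RN N, z.1 ∉ Ω → u z.1 = 0 :=
    Measure.quasiMeasurePreserving_fst.ae hu
  have h2 : ∀ᵐ z : RN N × RN N, z.2 ∉ Ω → u z.2 = 0 :=
    Measure.quasiMeasurePreserving_snd.ae hu
  filter_upwards [h1, h2] with z h1 h2
  by_cases hz : z ∈ Qset Ω
  · rw [indicator_of_mem hz]
  · have hz' : z.1 ∉ Ω ∧ z.2 ∉ Ω := by simpa [Qset] using hz
    rw [h1 hz'.1, h2 hz'.2]
    simp [ENNReal.zero_rpow_of_pos (one_pos.trans_le (hp₁ z.1 z.2))]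

lemma exists_gmodular_lt_one {Ω : Set (RN N)} {s p : RN N → RN N → ℝ} {β : RN N → ℝ}
    (hp₁ : ∀ x y, 1 ≤ p x y) {u : RN N → ℝ} (hu : MemX0 Ω s p β u) :
    ∃ l, 0 < l ∧ gmodular univ s p u l < 1 := by
  obtain ⟨-, -, ⟨l, hl, hlt⟩, h0⟩ := hu
  have hfin := (gmodular_univ_le_Qset (s := s) hp₁ h0 l).trans_lt hlt
  set g := (gmodular univ s p u l).toReal with hg
  have hg0 : 0 ≤ g := ENNReal.toReal_nonneg
  refine ⟨l * (g + 1), by positivity,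
    (gmodular_mul_le hp₁ (by linarith) univ).trans_lt ?_⟩
  rw [← ENNReal.ofReal_toReal hfin.ne, ← hg, ← ENNReal.ofReal_mul (by positivity),
    ENNReal.ofReal_lt_one, inv_mul_lt_one₀ (by positivity)]
  linarith

lemma exists_choquard_modular_le [NeZero N] {Ω : Set (RN N)} (hΩm : MeasurableSet Ω)
    (hΩb : Bornology.IsBounded Ω) {s p μ : RN N → RN N → ℝ}
    (hs : Continuous fun z : RN N × RN N => s z.1 z.2)
    (hp : Continuous fun z : RN N × RN N => p z.1 z.2) (hp₁ : ∀ x y, 1 ≤ p x y)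
    (hs₀ : ∀ x y, 0 < s x y) (hsp : ∀ x y, s x y * p x y < N) {r : RN N → ℝ}
    (hr : Continuous r) (hr₀ : ∀ x, 0 ≤ r x) {a ν : ℝ} (ha₁ : 1 < a) (ha₂ : a < 2)
    (hrp : ∀ x ∈ closure Ω, r x * a < pstar s p x) (hμ₀ : ∀ x y, 0 < μ x y)
    (hμν : ∀ x y, μ x y ≤ ν) (hν : ν * (2 - 2 / a)⁻¹ < N) :
    ∃ C : ℝ≥0∞, C ≠ ⊤ ∧ ∀ v, InModularBall Ω s p v →
      ∫⁻ x in Ω, ∫⁻ y in Ω, ENNReal.ofReal |v x| ^ r x * ENNReal.ofReal |v y| ^ r y *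
        ENNReal.ofReal (1 / dist x y ^ μ x y) ≤ C := by
  obtain ⟨L, hL, hΩL⟩ := hΩb.subset_ball_lt 1 0
  have hdist : ∀ x ∈ Ω, ∀ y ∈ Ω, dist x y < 2 * L := fun x hx y hy => by
    have h1 := Metric.mem_ball.1 (hΩL hx)
    have h2 := Metric.mem_ball.1 (hΩL hy)
    have h3 := dist_triangle_right x y 0
    linarith
  have hν₀ : 0 < ν := (hμ₀ 0 0).trans_le (hμν 0 0)
  have ht : 0 < (2 - 2 / a)⁻¹ := by
    rw [inv_pos, sub_pos, div_lt_iff₀ (by linarith)]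
    linarith
  set t := (2 - 2 / a)⁻¹ with htdef
  obtain ⟨C, hC, hCv⟩ := exists_lintegral_rpow_le hΩm hΩb hs hp hp₁ hs₀ hsp
    (hr.mul_const a) (fun x => mul_nonneg (hr₀ x) (by linarith)) hrp
  obtain ⟨G, hG, hGx⟩ := lintegral_dist_rpow_neg_le (N := N) (R := 2 * L) hν
  set D := ENNReal.ofReal ((2 * L) ^ ν) with hD
  have hDG : D ^ t * G ≠ ⊤ :=
    ENNReal.mul_ne_top (ENNReal.rpow_ne_top_of_nonneg ht.le ENNReal.ofReal_ne_top) hG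
  refine ⟨C * C + C * (D ^ t * G) + C * (D ^ t * G), ?_, fun v hv => ?_⟩
  · exact ENNReal.add_ne_top.2 ⟨ENNReal.add_ne_top.2 ⟨ENNReal.mul_ne_top hC hC,
      ENNReal.mul_ne_top hC hDG⟩, ENNReal.mul_ne_top hC hDG⟩
  calc ∫⁻ x in Ω, ∫⁻ y in Ω, ENNReal.ofReal |v x| ^ r x * ENNReal.ofReal |v y| ^ r y *
        ENNReal.ofReal (1 / dist x y ^ μ x y)
      ≤ ∫⁻ x in Ω, ∫⁻ y in Ω, ENNReal.ofReal |v x| ^ r x * ENNReal.ofReal |v y| ^ r y *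
        (D * ENNReal.ofReal (dist x y) ^ (-ν)) := by
        refine setLIntegral_mono' hΩm fun x hx => setLIntegral_mono' hΩm fun y hy => ?_
        gcongr
        exact ofReal_one_div_rpow_le dist_nonneg (hdist x hx y hy).le (by linarith) (hμ₀ x y)
          (hμν x y)
    _ ≤ _ := by
        refine lintegral_lintegral_mul_kernel_le (w := fun x => ENNReal.ofReal |v x| ^ r x)
          (k := fun x y => D * ENNReal.ofReal (dist x y) ^ (-ν)) ha₁ ha₂ ?_ ?_ ?_ ?_ ?_
        · exact hv.measurable.abs.ennreal_ofReal.pow hr.measurable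
        · exact ((measurable_fst.dist measurable_snd).ennreal_ofReal.pow_const _).const_mul D
        · intro x y
          rw [dist_comm]
        · exact (lintegral_congr fun x => (ENNReal.rpow_mul _ _ _).symm).trans_le (hCv v hv)
        · refine (ae_restrict_iff' hΩm).2 (Eventually.of_forall fun x hx => ?_)
          have hk : ∀ y, (D * ENNReal.ofReal (dist x y) ^ (-ν)) ^ t =
              D ^ t * ENNReal.ofReal (dist x y) ^ (-(ν * t)) := fun y => by
            rw [ENNReal.mul_rpow_of_nonneg _ _ ht.le, ← ENNReal.rpow_mul, neg_mul]
          refine (lintegral_congr hk).trans_le ?_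
          rw [lintegral_const_mul' _ _
            (ENNReal.rpow_ne_top_of_nonneg ht.le ENNReal.ofReal_ne_top)]
          gcongr
          refine (lintegral_mono_set fun y hy => ?_).trans (hGx x)
          exact Metric.mem_ball'.2 (hdist x hx y hy)

lemma le_of_inf2 {g : RN N → RN N → ℝ} (hg : 0 < inf2 g) (x y : RN N) : inf2 g ≤ g x y := by
  refine csInf_le ?_ ⟨x, y, rfl⟩
  by_contra h
  rw [inf2, Real.sInf_of_not_bddBelow h] at hg
  exact lt_irrefl _ hg

lemma le_sup2 {g : RN N → RN N → ℝ} (hg : BddAbove {t | ∃ x y, g x y = t}) (x y : RN N) :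
    g x y ≤ sup2 g :=
  le_csSup hg ⟨x, y, rfl⟩

lemma infOn_univ_le {g : RN N → ℝ} (hg : 0 < infOn univ g) (x : RN N) : infOn univ g ≤ g x := by
  refine csInf_le ?_ (mem_image_of_mem g (mem_univ x))
  by_contra h
  rw [infOn, Real.sInf_of_not_bddBelow h] at hg
  exact lt_irrefl _ hg

/-- There is room above the exponent `q⁺` in the conditions `r q⁺ < p_s*` and `q⁺ < 2`. -/
lemma exists_gt_mul_lt_pstar {Ω : Set (RN N)} (hΩb : Bornology.IsBounded Ω)
    (hΩne : Ω.Nonempty) {s p : RN N → RN N → ℝ}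
    (hs : Continuous fun z : RN N × RN N => s z.1 z.2)
    (hp : Continuous fun z : RN N × RN N => p z.1 z.2)
    (hsp : ∀ x y, s x y * p x y < N) {r : RN N → ℝ}
    (hr : Continuous r) (hr₀ : ∀ x, 0 < r x) {Q : ℝ} (hQ : Q < 2)
    (hrp : ∀ x, r x * Q < pstar s p x) :
    ∃ a, Q < a ∧ a < 2 ∧ ∀ x ∈ closure Ω, r x * a < pstar s p x := by
  have hs' : Continuous fun x : RN N => s x x := hs.comp (continuous_id.prodMk continuous_id)
  have hp' : Continuous fun x : RN N => p x x := hp.comp (continuous_id.prodMk continuous_id)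
  have hcont : Continuous fun x => pstar s p x / r x := by
    unfold pstar
    refine Continuous.div (Continuous.div (by fun_prop) (by fun_prop) fun x => ?_) hr
      fun x => (hr₀ x).ne'
    exact (sub_pos.2 (hsp x x)).ne'
  obtain ⟨x₁, -, hx₁⟩ := hΩb.isCompact_closure.exists_isMinOn hΩne.closure hcont.continuousOn
  have h1 : Q < pstar s p x₁ / r x₁ := by
    rw [lt_div_iff₀ (hr₀ x₁), mul_comm]
    exact hrp x₁
  obtain ⟨a, ha, ha'⟩ := exists_between (lt_min h1 hQ)
  refine ⟨a, ha, ha'.trans_le (min_le_right _ _), fun x hx => ?_⟩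
  have h2 : a < pstar s p x / r x := (ha'.trans_le (min_le_left _ _)).trans_le (hx₁ hx)
  rwa [lt_div_iff₀ (hr₀ x), mul_comm] at h2

/-- The double integral of `F(·, u)` scales like the modular of `u`. -/
lemma enorm_choquard_le {Ω : Set (RN N)} (hΩm : MeasurableSet Ω) {f : RN N → ℝ → ℝ} {M : ℝ}
    {r : RN N → ℝ} (hf : F1 Ω f M r) {μ : RN N → RN N → ℝ} {r₁ r₂ : ℝ}
    (hr : ∀ x, 1 < r x) (hr₁ : ∀ x, r₁ ≤ r x) (hr₂ : ∀ x, r x ≤ r₂) {u : RN N → ℝ} {l : ℝ}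
    (hl : 0 < l) :
    ‖∫ x in Ω, ∫ y in Ω, Fant f x (u x) * Fant f y (u y) / dist x y ^ μ x y‖ₑ ≤
      ENNReal.ofReal (M ^ 2 * max (l ^ (2 * r₂)) (l ^ (2 * r₁))) *
      ∫⁻ x in Ω, ∫⁻ y in Ω, ENNReal.ofReal |u x / l| ^ r x * ENNReal.ofReal |u y / l| ^ r y *
        ENNReal.ofReal (1 / dist x y ^ μ x y) := by
  have hM := hf.1
  have hFl : ∀ x ∈ Ω, |Fant f x (u x)| ≤ M * l ^ r x * |u x / l| ^ r x := by
    intro x hx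
    refine (abs_Fant_le hf hx (hr x) (u x)).trans_eq ?_
    rw [mul_assoc, ← Real.mul_rpow hl.le (abs_nonneg _), abs_div, abs_of_pos hl,
      mul_div_cancel₀ _ hl.ne']
  have hpow : ∀ x y, l ^ r x * l ^ r y ≤ max (l ^ (2 * r₂)) (l ^ (2 * r₁)) := by
    intro x y
    rw [← Real.rpow_add hl]
    rcases le_total 1 l with h | h
    · exact (Real.rpow_le_rpow_of_exponent_le h (by linarith [hr₂ x, hr₂ y])).trans
        (le_max_left _ _)
    · exact (Real.rpow_le_rpow_of_exponent_ge hl h (by linarith [hr₁ x, hr₁ y])).trans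
        (le_max_right _ _)
  refine (enorm_integral_le_lintegral_enorm _).trans ?_
  rw [← lintegral_const_mul' _ _ ENNReal.ofReal_ne_top]
  refine setLIntegral_mono' hΩm fun x hx => (enorm_integral_le_lintegral_enorm _).trans ?_
  rw [← lintegral_const_mul' _ _ ENNReal.ofReal_ne_top]
  refine setLIntegral_mono' hΩm fun y hy => ?_
  have hrx := hr x
  have hry := hr y
  rw [ENNReal.ofReal_rpow_of_nonneg (abs_nonneg _) (by linarith),
    ENNReal.ofReal_rpow_of_nonneg (abs_nonneg _) (by linarith),
    ← ENNReal.ofReal_mul (by positivity), ← ENNReal.ofReal_mul (by positivity),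
    ← ENNReal.ofReal_mul (by positivity), Real.enorm_eq_ofReal_abs]
  refine ENNReal.ofReal_le_ofReal ?_
  rw [abs_div, abs_mul, abs_of_nonneg (by positivity : 0 ≤ dist x y ^ μ x y), div_eq_mul_one_div,
    ← mul_assoc]
  refine mul_le_mul_of_nonneg_right ?_ (by positivity)
  calc |Fant f x (u x)| * |Fant f y (u y)|
      ≤ (M * l ^ r x * |u x / l| ^ r x) * (M * l ^ r y * |u y / l| ^ r y) :=
        mul_le_mul (hFl x hx) (hFl y hy) (abs_nonneg _) (by positivity)
    _ = M ^ 2 * (l ^ r x * l ^ r y) * (|u x / l| ^ r x * |u y / l| ^ r y) := by ring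
    _ ≤ _ := by
        gcongr
        exact hpow x y

/-- Estimate of the double Choquard term (estimate (4.3)). -/
theorem statement16 {N : ℕ} (hN : 2 ≤ N) (Ω : Set (RN N))
    (hΩo : IsOpen Ω) (hΩb : Bornology.IsBounded Ω) (hΩne : Ω.Nonempty)
    (s p μ q : RN N → RN N → ℝ) (f : RN N → ℝ → ℝ) (M : ℝ) (r : RN N → ℝ)
    (hs : S1 s) (hp : P1 s p) (hμ : Mu1 μ) (hq : CPlus2 q)
    (hqμ : ∀ x y, 2 / q x y + μ x y / (N : ℝ) = 2)
    (hf : Caratheodory f)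
    (hr : CPlusOn univ r) (hrM : MemM s p q r) (hrp : sup2 p < infOn univ r)
    (hf1 : F1 Ω f M r) :
    ∃ c : ℝ, 0 < c ∧ ∀ u : RN N → ℝ, MemX0 Ω s p (fun x => p x x) u →
      |∫ x in Ω, ∫ y in Ω,
          Fant f x (u x) * Fant f y (u y) / dist x y ^ μ x y| ≤
        c * max (x0Norm s p u ^ (2 * supOn univ r))
          (x0Norm s p u ^ (2 * infOn univ r)) := by
  obtain ⟨hsc, -, hsb, hs0, -⟩ := hs
  obtain ⟨⟨hpc, hp1, hpb⟩, -, hsp⟩ := hp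
  obtain ⟨-, hμb, hμ0, hμN⟩ := hμ
  obtain ⟨-, hq1, hqb⟩ := hq
  obtain ⟨hrc, hr1, hrb⟩ := hr
  have : NeZero N := ⟨by omega⟩
  have hN0 : (0 : ℝ) < N := by exact_mod_cast (by omega : 0 < N)
  have hΩm := hΩo.measurableSet
  have hs₀ : ∀ x y, 0 < s x y := fun x y => hs0.trans_le (le_of_inf2 hs0 x y)
  have hp₁ : ∀ x y, 1 ≤ p x y := fun x y => hp1.le.trans (le_of_inf2 (one_pos.trans hp1) x y)
  have hsplt : ∀ x y, s x y * p x y < N := fun x y =>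
    (mul_le_mul (le_sup2 hsb x y) (le_sup2 hpb x y) (zero_le_one.trans (hp₁ x y))
      ((hs₀ x y).le.trans (le_sup2 hsb x y))).trans_lt hsp
  have hμ₀ : ∀ x y, 0 < μ x y := fun x y => hμ0.trans_le (le_of_inf2 hμ0 x y)
  have hq₁ : ∀ x y, 1 < q x y := fun x y => hq1.trans_le (le_of_inf2 (one_pos.trans hq1) x y)
  have hr₁ : ∀ x, infOn univ r ≤ r x := infOn_univ_le (one_pos.trans hr1)
  have hr₂ : ∀ x, r x ≤ supOn univ r := fun x => le_csSup hrb (mem_image_of_mem r (mem_univ x))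
  have hr₁' : ∀ x, 1 < r x := fun x => hr1.trans_le (hr₁ x)
  have hrcont : Continuous r := continuousOn_univ.1 hrc
  have hQ1 : 1 < sup2 q := (hq₁ 0 0).trans_le (le_sup2 hqb 0 0)
  have hμQ : ∀ x y, μ x y ≤ N * (2 - 2 / sup2 q) := by
    intro x y
    have h1 := hqμ x y
    have h2 : 2 / sup2 q ≤ 2 / q x y :=
      div_le_div_of_nonneg_left zero_le_two (by linarith [hq₁ x y]) (le_sup2 hqb x y)
    rw [← div_le_iff₀' hN0]
    linarith
  have hQ2 : sup2 q < 2 := by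
    set m := sup2 μ / N with hm
    have hm1 : m < 1 := (div_lt_one hN0).2 hμN
    have h1 : sup2 q ≤ 2 / (2 - m) := by
      refine csSup_le ⟨_, 0, 0, rfl⟩ ?_
      rintro _ ⟨x, y, rfl⟩
      have hqpos : 0 < q x y := by linarith [hq₁ x y]
      have h2 : μ x y / N ≤ m := div_le_div_of_nonneg_right (le_sup2 hμb x y) hN0.le
      have h3 : 2 - m ≤ 2 / q x y := by linarith [hqμ x y]
      rw [le_div_iff₀ (by linarith), mul_comm]
      rwa [le_div_iff₀ hqpos] at h3
    refine h1.trans_lt ?_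
    rw [div_lt_iff₀ (by linarith)]
    linarith
  obtain ⟨a, hQa, ha2, hra⟩ := exists_gt_mul_lt_pstar hΩb hΩne hsc hpc hsplt hrcont
    (fun x => one_pos.trans (hr₁' x)) hQ2 fun x => (hrM x).2.2
  have ha1 : 1 < a := hQ1.trans hQa
  have hν : N * (2 - 2 / sup2 q) * (2 - 2 / a)⁻¹ < N := by
    have h1 : 2 / a < 2 / sup2 q := div_lt_div_of_pos_left two_pos (by linarith) hQa
    have h2 : 2 / a < 2 := by rw [div_lt_iff₀ (by linarith)]; linarith
    rw [← div_eq_mul_inv, div_lt_iff₀ (by linarith)]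
    exact mul_lt_mul_of_pos_left (by linarith) hN0
  obtain ⟨C, hC, hCv⟩ := exists_choquard_modular_le hΩm hΩb hsc hpc hp₁ hs₀ hsplt hrcont
    (fun x => (one_pos.trans (hr₁' x)).le) ha1 ha2 hra hμ₀ hμQ hν
  have hM := hf1.1
  refine ⟨M ^ 2 * (C.toReal + 1), by positivity, fun u hu => ?_⟩
  set I := ∫ x in Ω, ∫ y in Ω, Fant f x (u x) * Fant f y (u y) / dist x y ^ μ x y with hI
  have hlev : ∀ l ∈ {l | 0 < l ∧ gmodular univ s p u l < 1}, |I| ≤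
      M ^ 2 * (C.toReal + 1) *
        max (l ^ (2 * supOn univ r)) (l ^ (2 * infOn univ r)) := by
    rintro l ⟨hl, hlt⟩
    have hv : InModularBall Ω s p fun x => u x / l :=
      ⟨hu.1.div_const l, hu.2.2.2.mono fun x hx hxΩ => by rw [hx hxΩ, zero_div],
        (gmodular_one_div hl).trans_le hlt.le⟩
    have h1 := (enorm_choquard_le (μ := μ) hΩm hf1 hr₁' hr₁ hr₂ (u := u) hl).trans
      (mul_le_mul_right (hCv _ hv) _)
    rw [← hI, Real.enorm_eq_ofReal_abs, ← ENNReal.ofReal_toReal hC,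
      ← ENNReal.ofReal_mul (by positivity), ENNReal.ofReal_le_ofReal_iff (by positivity)] at h1
    refine h1.trans ?_
    have h2 : 0 ≤ M ^ 2 * max (l ^ (2 * supOn univ r)) (l ^ (2 * infOn univ r)) := by positivity
    linarith
  have hne : {l | 0 < l ∧ gmodular univ s p u l < 1}.Nonempty := exists_gmodular_lt_one hp₁ hu
  obtain ⟨l, -, hltend, hlmem⟩ := exists_seq_tendsto_sInf hne ⟨0, fun l hl => hl.1.le⟩
  have hinf : 0 ≤ 2 * infOn univ r := by linarith
  have hsup : 0 ≤ 2 * supOn univ r := by linarith [hr₁ 0, hr₂ 0]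
  have hφ : Continuous fun l : ℝ => M ^ 2 * (C.toReal + 1) *
      max (l ^ (2 * supOn univ r)) (l ^ (2 * infOn univ r)) :=
    continuous_const.mul
      ((Real.continuous_rpow_const hsup).max (Real.continuous_rpow_const hinf))
  exact ge_of_tendsto' ((hφ.tendsto _).comp hltend) fun n => hlev _ (hlmem n)

end VarOrderChoquard
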